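/- arXiv:2511.09595 — 4 statements merged into one kernel-verified Lean document; each statement's English description precedes it below -/
import Mathlib

section
/- Let A be an AB3 (cocomplete) abelian category. Then A is AB4 (coproducts of short exact sequences are short exact) if and only if for every nonempty set I, every family {A_i}_{i∈I} of objects and every object B, the natural map Ext¹(⨁_{i∈I} A_i, B) → ∏_{i∈I} Ext¹(A_i, B), sending η to the family (η · μ_i)_{i∈I} of pullbacks along the coproduct inclusions μ_i : A_i → ⨁ A_i, is an isomorphism of abelian groups. -/
open CategoryTheory CategoryTheory.Limits CategoryTheory.Abelian

universe w v u

/-- The coproduct of a family of short complexes. -/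
noncomputable def sigmaShortComplex {A : Type u} [Category.{v} A] [Abelian A]
    {I : Type w} (S : I → ShortComplex A)
    [HasCoproduct (fun i => (S i).X₁)] [HasCoproduct (fun i => (S i).X₂)]
    [HasCoproduct (fun i => (S i).X₃)] : ShortComplex A :=
  ShortComplex.mk (Limits.Sigma.map fun i => (S i).f) (Limits.Sigma.map fun i => (S i).g)
    (by rw [Limits.Sigma.map_comp_map]; ext i; simp [(S i).zero])

namespace CategoryTheory

section

variable {A : Type u} [Category.{v} A] [Abelian A]

lemma ShortComplex.shortExact_of_mono {X Y : A} (a : X ⟶ Y) [Mono a] :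
    (ShortComplex.mk a (cokernel.π a) (cokernel.condition a)).ShortExact :=
  { exact := ShortComplex.exact_of_g_is_cokernel _ (cokernelIsCokernel a) }

lemma ShortComplex.shortExact_of_epi {X Y : A} (p : X ⟶ Y) [Epi p] :
    (ShortComplex.mk (kernel.ι p) p (kernel.condition p)).ShortExact :=
  { exact := ShortComplex.exact_of_f_is_kernel _ (kernelIsKernel p) }

end

namespace Abelian.Ext

variable {A : Type u} [Category.{v} A] [Abelian A]

/-- A quasi-isomorphism from a complex in nonpositive degrees to an object in degree zero
is an epimorphism in degree zero. -/
lemma epi_f_zero_of_quasiIso {K : CochainComplex A ℤ} [K.IsStrictlyLE 0] {X : A}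
    (s : K ⟶ (HomologicalComplex.single A (ComplexShape.up ℤ) 0).obj X) [QuasiIso s] : Epi (s.f 0) := by
  let L := (HomologicalComplex.single A (ComplexShape.up ℤ) 0).obj X
  have hK : IsIso (K.iCycles 0) :=
    K.isIso_iCycles 0 1 (by simp) ((K.isZero_of_isStrictlyLE 0 1).eq_of_tgt _ _)
  have hL : IsIso (L.iCycles 0) :=
    L.isIso_iCycles 0 1 (by simp)
      ((HomologicalComplex.isZero_single_obj_X _ _ _ _ (by simp)).eq_of_tgt _ _)
  have hL' : IsIso (L.homologyπ 0) :=
    L.isIso_homologyπ (-1) 0 (by simp)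
      ((HomologicalComplex.isZero_single_obj_X _ _ _ _ (by simp)).eq_of_src _ _)
  have h₁ : Epi (HomologicalComplex.cyclesMap s 0 ≫ L.homologyπ 0) := by
    rw [← HomologicalComplex.homologyπ_naturality]
    infer_instance
  have h₂ : HomologicalComplex.cyclesMap s 0 =
      (HomologicalComplex.cyclesMap s 0 ≫ L.homologyπ 0) ≫ inv (L.homologyπ 0) := by simp
  have h₃ : Epi (HomologicalComplex.cyclesMap s 0) := by
    rw [h₂]
    infer_instance
  have h₄ : Epi (K.iCycles 0 ≫ s.f 0) := by
    rw [← HomologicalComplex.cyclesMap_i]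
    exact epi_comp _ _
  exact epi_of_epi (K.iCycles 0) _

variable [HasExt.{w} A]

/-- Every class in `Ext X Y 1` is killed by pulling back along some epimorphism to `X`. -/
lemma exists_epi_comp_eq_zero {X Y : A} (η : Ext X Y 1) :
    ∃ (P : A) (p : P ⟶ X), Epi p ∧ (mk₀ p).comp η (zero_add 1) = 0 := by
  let := HasDerivedCategory.standard A
  let F := HomologicalComplex.single A (ComplexShape.up ℤ) 0
  let e : (DerivedCategory.Q.obj (F.obj Y))⟦(1 : ℤ)⟧ ≅ DerivedCategory.Q.obj ((F.obj Y)⟦(1 : ℤ)⟧) :=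
    ((DerivedCategory.Q.commShiftIso (1 : ℤ)).app (F.obj Y)).symm
  let φ : DerivedCategory.Q.obj (F.obj X) ⟶ (DerivedCategory.Q.obj (F.obj Y))⟦(1 : ℤ)⟧ := η.hom
  obtain ⟨K, _, s, hs, g, fac⟩ := DerivedCategory.right_fac_of_isStrictlyLE (φ ≫ e.hom) 0
  have hs' : QuasiIso s := (DerivedCategory.isIso_Q_map_iff_quasiIso (C := A) s).1 hs
  let p : K.X 0 ⟶ X := s.f 0 ≫ (HomologicalComplex.singleObjXSelf _ 0 X).hom
  have := epi_f_zero_of_quasiIso s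
  refine ⟨K.X 0, p, epi_comp _ _, ?_⟩
  let i : F.obj (K.X 0) ⟶ K :=
    HomologicalComplex.mkHomFromSingle (𝟙 _) (fun k hk => by
      obtain rfl : 1 = k := by simpa using hk
      exact (K.isZero_of_isStrictlyLE 0 1).eq_of_tgt _ _)
  have his : F.map p = i ≫ s := by
    apply HomologicalComplex.from_single_hom_ext
    simp [F, i, p, HomologicalComplex.single_map_f_self]
  have hig : i ≫ g = 0 := by
    apply HomologicalComplex.from_single_hom_ext
    exact (HomologicalComplex.isZero_single_obj_X (ComplexShape.up ℤ) 0 Y (0 + 1)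
      (by simp)).eq_of_tgt _ _
  have key : DerivedCategory.Q.map (F.map p) ≫ φ = 0 := by
    rw [← cancel_mono e.hom, Category.assoc, fac, his, Functor.map_comp, Category.assoc,
      IsIso.hom_inv_id_assoc, ← Functor.map_comp, hig, Functor.map_zero, Limits.zero_comp]
  ext
  rw [← singleFunctor_map_comp_hom, zero_hom]
  exact key

/-- Every class in `Ext X Y 1` is the pushout of the class of an extension of `X`. -/
lemma exists_extClass_comp_eq {X Y : A} (η : Ext X Y 1) :
    ∃ (K P : A) (f : K ⟶ P) (p : P ⟶ X) (w : f ≫ p = 0)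
      (hS : (ShortComplex.mk f p w).ShortExact) (x : K ⟶ Y),
      hS.extClass.comp (mk₀ x) (add_zero 1) = η := by
  obtain ⟨P, p, _, hp⟩ := exists_epi_comp_eq_zero η
  have hS := ShortComplex.shortExact_of_epi p
  obtain ⟨x, hx⟩ := contravariant_sequence_exact₃ hS _ η hp (add_zero 1)
  obtain ⟨x, rfl⟩ := (mk₀_bijective _ _).2 x
  exact ⟨_, _, _, p, _, hS, x, hx⟩

/-- Every class in `Ext X Y 1` is the pullback of the class of an extension by `Y`. -/
lemma exists_comp_extClass_eq {X Y : A} (η : Ext X Y 1) :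
    ∃ (E Q : A) (a : Y ⟶ E) (q : E ⟶ Q) (w : a ≫ q = 0)
      (hS : (ShortComplex.mk a q w).ShortExact) (x : X ⟶ Q),
      (mk₀ x).comp hS.extClass (zero_add 1) = η := by
  obtain ⟨K, P, f, p, w, hS, x, rfl⟩ := exists_extClass_comp_eq η
  have := hS.mono_f
  have := hS.epi_g
  dsimp at *
  have hT := ShortComplex.shortExact_of_mono (pushout.inr f x)
  let t : X ⟶ cokernel (pushout.inr f x) :=
    hS.exact.desc (pushout.inl f x ≫ cokernel.π _) (by
      dsimp
      rw [pushout.condition_assoc, cokernel.condition, Limits.comp_zero])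
  let φ : ShortComplex.mk f p w ⟶
      ShortComplex.mk (pushout.inr f x) (cokernel.π (pushout.inr f x))
        (cokernel.condition _) :=
    { τ₁ := x
      τ₂ := pushout.inl f x
      τ₃ := t
      comm₁₂ := pushout.condition.symm
      comm₂₃ := (hS.exact.g_desc _ _).symm }
  exact ⟨_, _, _, _, _, hT, t, (ShortComplex.ShortExact.extClass_naturality hS hT φ).symm⟩

variable {I : Type*} {f : I → A} [HasCoproduct f]

/-- A class of degree one on a coproduct is determined by its restrictions to the summands. -/
lemma eq_zero_of_forall_ι_comp_eq_zero {B : A} (η : Ext (∐ f) B 1)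
    (h : ∀ i, (mk₀ (Sigma.ι f i)).comp η (zero_add 1) = 0) : η = 0 := by
  obtain ⟨E, Q, a, q, w, hS, x, rfl⟩ := exists_comp_extClass_eq η
  have exists_lift (i : I) : ∃ b : f i ⟶ E, b ≫ q = Sigma.ι f i ≫ x := by
    obtain ⟨b, hb⟩ := covariant_sequence_exact₃ (f i) hS (mk₀ (Sigma.ι f i ≫ x)) (zero_add 1)
      (by simpa using h i)
    obtain ⟨b, rfl⟩ := (mk₀_bijective _ _).2 b
    exact ⟨b, (mk₀_bijective _ _).1 (by simpa using hb)⟩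
  choose b hb using exists_lift
  have hx : x = Limits.Sigma.desc b ≫ q := by
    ext i
    simp [hb]
  rw [hx, ← mk₀_comp_mk₀_assoc, hS.comp_extClass, comp_zero]

end Abelian.Ext

end CategoryTheory

section

variable {A : Type u} [Category.{v} A] [Abelian A] {I : Type*} (S : I → ShortComplex A)
  [HasCoproduct (fun i => (S i).X₁)] [HasCoproduct (fun i => (S i).X₂)]
  [HasCoproduct (fun i => (S i).X₃)]

/-- The inclusion of a summand in a coproduct of short complexes. -/
noncomputable def sigmaShortComplexι (i : I) : S i ⟶ sigmaShortComplex S where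
  τ₁ := Sigma.ι (fun i => (S i).X₁) i
  τ₂ := Sigma.ι (fun i => (S i).X₂) i
  τ₃ := Sigma.ι (fun i => (S i).X₃) i
  comm₁₂ := by simp [sigmaShortComplex]
  comm₂₃ := by simp [sigmaShortComplex]

variable {S}

lemma epi_sigmaShortComplex_g (hS : ∀ i, (S i).ShortExact) : Epi (sigmaShortComplex S).g := by
  have (i : I) : Epi (S i).g := (hS i).epi_g
  dsimp [sigmaShortComplex]
  infer_instance

lemma sigmaShortComplex_exact (hS : ∀ i, (S i).ShortExact) : (sigmaShortComplex S).Exact := by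
  have (i : I) : Epi (S i).g := (hS i).epi_g
  have := epi_sigmaShortComplex_g hS
  have hw {Z : A} (k : (sigmaShortComplex S).X₂ ⟶ Z) (hk : (sigmaShortComplex S).f ≫ k = 0)
      (i : I) : (S i).f ≫ (sigmaShortComplexι S i).τ₂ ≫ k = 0 := by
    rw [← Category.assoc, ← (sigmaShortComplexι S i).comm₁₂, Category.assoc, hk, comp_zero]
  refine ShortComplex.exact_of_g_is_cokernel _
    (CokernelCofork.IsColimit.ofπ' _ _ fun {Z} k hk =>
      ⟨Sigma.desc fun i => (hS i).exact.desc _ (hw k hk i), ?_⟩)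
  dsimp [sigmaShortComplex]
  ext i
  simp [sigmaShortComplexι]

lemma sigmaShortComplex_shortExact (hS : ∀ i, (S i).ShortExact)
    (h : Mono (sigmaShortComplex S).f) : (sigmaShortComplex S).ShortExact :=
  { exact := sigmaShortComplex_exact hS
    epi_g := epi_sigmaShortComplex_g hS }

variable [HasExt.{w} A]

lemma exists_ι_comp_eq_of_sigmaShortComplex {f : I → A} [HasCoproduct f] {B : A}
    (K P : I → A) (k : ∀ i, K i ⟶ P i) (p : ∀ i, P i ⟶ f i) (hw : ∀ i, k i ≫ p i = 0)
    (hS : ∀ i, (ShortComplex.mk (k i) (p i) (hw i)).ShortExact)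
    [HasCoproduct K] [HasCoproduct P]
    (hSigma : (sigmaShortComplex fun i => ShortComplex.mk (k i) (p i) (hw i)).ShortExact)
    (x : ∀ i, K i ⟶ B) :
    ∃ η : Ext (∐ f) B 1, ∀ i, (Ext.mk₀ (Sigma.ι f i)).comp η (zero_add 1) =
      (hS i).extClass.comp (Ext.mk₀ (x i)) (add_zero 1) := by
  refine ⟨hSigma.extClass.comp (Ext.mk₀ (Sigma.desc x)) (add_zero 1), fun i => ?_⟩
  have h := (hS i).extClass_naturality hSigma
    (sigmaShortComplexι (fun i => ShortComplex.mk (k i) (p i) (hw i)) i)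
  have h' := congr_arg (fun z => z.comp (Ext.mk₀ (Sigma.desc x)) (add_zero 1)) h
  dsimp [sigmaShortComplexι] at h'
  rw [Ext.comp_assoc_of_third_deg_zero, Ext.comp_assoc_of_third_deg_zero] at h'
  refine h'.symm.trans ?_
  congr 1
  exact (Ext.mk₀_comp_mk₀ _ _).trans (congr_arg Ext.mk₀ (Sigma.ι_desc _ _))

/-- If the classes of the extensions `S i`, pushed out to `∐ (S i).X₁`, come from a common class
on `∐ (S i).X₃`, then the coproduct of the monomorphisms `(S i).f` is a monomorphism. -/
lemma mono_sigmaShortComplex_f (hS : ∀ i, (S i).ShortExact)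
    (η : Ext (∐ fun i => (S i).X₃) (∐ fun i => (S i).X₁) 1)
    (hη : ∀ i, (Ext.mk₀ (Sigma.ι (fun i => (S i).X₃) i)).comp η (zero_add 1) =
      (hS i).extClass.comp (Ext.mk₀ (Sigma.ι (fun i => (S i).X₁) i)) (add_zero 1)) :
    Mono (sigmaShortComplex S).f := by
  obtain ⟨E, Q, a, q, _, hT, x, rfl⟩ := Ext.exists_comp_extClass_eq η
  have ha : Mono a := hT.mono_f
  have extend (i : I) : ∃ b : (S i).X₂ ⟶ E,
      (S i).f ≫ b = Sigma.ι (fun i => (S i).X₁) i ≫ a := by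
    obtain ⟨b, hb⟩ := Ext.contravariant_sequence_exact₁ (hS i) _
      (Ext.mk₀ (Sigma.ι (fun i => (S i).X₁) i ≫ a)) (add_zero 1) (by
        rw [← Ext.mk₀_comp_mk₀, ← Ext.comp_assoc_of_third_deg_zero, ← hη,
          Ext.comp_assoc_of_third_deg_zero, Ext.comp_assoc_of_third_deg_zero,
          hT.extClass_comp, Ext.comp_zero, Ext.comp_zero])
    obtain ⟨b, rfl⟩ := (Ext.mk₀_bijective _ _).2 b
    exact ⟨b, (Ext.mk₀_bijective _ _).1 (by simpa using hb)⟩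
  choose b hb using extend
  have fac : (sigmaShortComplex S).f ≫ Sigma.desc b = a := by
    dsimp [sigmaShortComplex]
    ext i
    simp [hb]
  have : Mono ((sigmaShortComplex S).f ≫ Sigma.desc b) := by rwa [fac]
  exact mono_of_mono _ (Sigma.desc b)

end

/-- an AB3 abelian category `A` is AB4 (coproducts of short exact sequences
are short exact) if and only if, for every nonempty set `I`, every family `{A_i}` and
every object `B`, the natural map `Ext¹(⨁ A_i, B) → ∏ Ext¹(A_i, B)` given by pulling
back along the coproduct inclusions is an isomorphism of abelian groups. -/
theorem stmt5 {A : Type u} [Category.{v} A] [Abelian A] [HasCoproducts.{v} A]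
    [CategoryTheory.HasExt.{w} A] :
    (∀ (I : Type v) (S : I → ShortComplex A), (∀ i, (S i).ShortExact) →
        (sigmaShortComplex S).ShortExact) ↔
    (∀ (I : Type v), Nonempty I → ∀ (f : I → A) (B : A),
      Function.Bijective (fun (η : Ext (∐ f) B 1) (i : I) =>
        (Ext.mk₀ (Sigma.ι f i)).comp η (zero_add 1))) := by
  constructor
  · intro h I _ f B
    constructor
    · intro η η' hη
      rw [← sub_eq_zero]
      refine Ext.eq_zero_of_forall_ι_comp_eq_zero _ fun i => ?_
      rw [sub_eq_add_neg, Ext.comp_add, Ext.comp_neg, ← sub_eq_add_neg, sub_eq_zero]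
      exact congr_fun hη i
    · intro η
      choose K P k p hw hS x hx using fun i => Ext.exists_extClass_comp_eq (η i)
      obtain ⟨ξ, hξ⟩ := exists_ι_comp_eq_of_sigmaShortComplex K P k p hw hS (h I _ hS) x
      exact ⟨ξ, funext fun i => (hξ i).trans (hx i)⟩
  · intro h I S hS
    refine sigmaShortComplex_shortExact hS ?_
    rcases isEmpty_or_nonempty I with hI | hI
    · refine ⟨fun _ _ _ => ?_⟩
      have : IsZero (∐ fun i => (S i).X₁) :=
        (IsZero.iff_id_eq_zero _).2 (Sigma.hom_ext _ _ fun i => hI.elim i)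
      exact this.eq_of_tgt _ _
    · obtain ⟨η, hη⟩ := (h I hI (fun i => (S i).X₃) (∐ fun i => (S i).X₁)).2
        fun i => (hS i).extClass.comp (Ext.mk₀ (Sigma.ι (fun i => (S i).X₁) i)) (add_zero 1)
      exact mono_sigmaShortComplex_f hS η fun i => congr_fun hη i
end

section
/- Let A be an AB3 abelian category with enough injectives. Then for any two objects V, D there exists a universal extension of V by D: there is a set X and η ∈ Ext¹(V^{(X)}, D) such that every element of Ext¹(V, D) is of the form η·f for some f : V → V^{(X)}. -/
open CategoryTheory CategoryTheory.Limits CategoryTheory.Abelian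

universe w v u

/-- an AB3 abelian category with enough injectives has universal extensions:
for any objects `V, D` there are a nonempty set `X` and `η ∈ Ext¹(V^{(X)}, D)` such that
every element of `Ext¹(V, D)` equals `η·f` for some `f : V ⟶ V^{(X)}`. -/
theorem stmt7 {A : Type u} [Category.{v} A] [Abelian A] [HasCoproducts.{v} A]
    [EnoughInjectives A] [CategoryTheory.HasExt.{w} A] (V D : A) :
    ∃ (X : Type v) (_ : Nonempty X) (η : Ext (∐ (fun _ : X => V)) D 1),
      ∀ ε : Ext V D 1, ∃ f : V ⟶ ∐ (fun _ : X => V),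
        ε = (Ext.mk₀ f).comp η (zero_add 1) := by
  let S := ShortComplex.mk (Injective.ι D) (cokernel.π (Injective.ι D)) (cokernel.condition _)
  have hS : S.ShortExact :=
    { exact := ShortComplex.exact_of_g_is_cokernel _ (cokernelIsCokernel _)
      mono_f := inferInstanceAs (Mono (Injective.ι D))
      epi_g := inferInstanceAs (Epi (cokernel.π (Injective.ι D))) }
  have : Injective S.X₂ := inferInstanceAs (Injective (Injective.under D))
  refine ⟨V ⟶ S.X₃, ⟨0⟩, (Ext.mk₀ (Sigma.desc fun g => g)).comp hS.extClass (zero_add 1),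
    fun ε => ?_⟩
  obtain ⟨x, hx⟩ := Ext.covariant_sequence_exact₁ V hS ε (Ext.eq_zero_of_injective _) (zero_add 1)
  obtain ⟨g, rfl⟩ := (Ext.mk₀_bijective V S.X₃).2 x
  refine ⟨Sigma.ι (fun _ : V ⟶ S.X₃ => V) g, ?_⟩
  rw [Ext.mk₀_comp_mk₀_assoc, Sigma.ι_desc]
  exact hx.symm
end

section
/- Let A be an abelian category with all small coproducts in which for every nonempty set I, every family {A_i} and every object B the canonical map τ : Ext¹(⨁_{i∈I} A_i, B) → ∏_{i∈I} Ext¹(A_i, B) is an isomorphism. Then A is AB4: for every family of short exact sequences 0 → B_i → E_i → A_i → 0, the coproduct sequence 0 → ⨁B_i → ⨁E_i → ⨁A_i → 0 is a short exact sequence. -/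
open CategoryTheory CategoryTheory.Limits CategoryTheory.Abelian

universe w v u

namespace DerivedCategory

variable {C : Type u} [Category.{v} C] [Abelian C] [HasDerivedCategory.{w} C]

open Pretriangulated

lemma exists_singleFunctor_obj_iso_of_distTriang (T : Triangle (DerivedCategory C))
    (hT : T ∈ distTriang (DerivedCategory C)) (n : ℤ)
    [T.obj₁.IsGE n] [T.obj₁.IsLE n] [T.obj₃.IsGE n] [T.obj₃.IsLE n] :
    ∃ E : C, Nonempty (T.obj₂ ≅ (singleFunctor C n).obj E) := by
  have : T.obj₂.IsGE n := by
    rw [isGE_iff]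
    intro i hi
    exact ((homologyFunctor C i).map_distinguished_exact T hT).isZero_of_both_zeros
      ((isZero_of_isGE T.obj₁ n i hi).eq_of_src _ _)
      ((isZero_of_isGE T.obj₃ n i hi).eq_of_tgt _ _)
  have : T.obj₂.IsLE n := by
    rw [isLE_iff]
    intro i hi
    exact ((homologyFunctor C i).map_distinguished_exact T hT).isZero_of_both_zeros
      ((isZero_of_isLE T.obj₁ n i hi).eq_of_src _ _)
      ((isZero_of_isLE T.obj₃ n i hi).eq_of_tgt _ _)
  exact exists_iso_singleFunctor_obj_of_isGE_of_isLE _ n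

/-- Every morphism `X ⟶ Y⟦1⟧` between objects of the heart is annihilated by a monomorphism
out of `Y`. -/
lemma exists_mono_comp_singleFunctor_map_shift_eq_zero {X Y : C}
    (η : (singleFunctor C 0).obj X ⟶ ((singleFunctor C 0).obj Y)⟦(1 : ℤ)⟧) :
    ∃ (E : C) (a : Y ⟶ E), Mono a ∧ η ≫ ((singleFunctor C 0).map a)⟦(1 : ℤ)⟧' = 0 := by
  obtain ⟨M, f, g, hT⟩ := distinguished_cocone_triangle₂ η
  have : (Triangle.mk f g η).obj₁.IsGE 0 := inferInstanceAs (((singleFunctor C 0).obj _).IsGE 0)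
  have : (Triangle.mk f g η).obj₁.IsLE 0 := inferInstanceAs (((singleFunctor C 0).obj _).IsLE 0)
  have : (Triangle.mk f g η).obj₃.IsGE 0 := inferInstanceAs (((singleFunctor C 0).obj _).IsGE 0)
  have : (Triangle.mk f g η).obj₃.IsLE 0 := inferInstanceAs (((singleFunctor C 0).obj _).IsLE 0)
  obtain ⟨E, ⟨e⟩⟩ := exists_singleFunctor_obj_iso_of_distTriang _ hT 0
  change M ≅ _ at e
  obtain ⟨a, ha⟩ := (singleFunctor C 0).map_surjective (f ≫ e.hom)
  refine ⟨E, a, Preadditive.mono_of_cancel_zero _ fun {Z} z hz => ?_, ?_⟩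
  · apply (singleFunctor C 0).map_injective
    have h : (singleFunctor C 0).map z ≫ f = 0 := by
      rw [← cancel_mono e.hom, Category.assoc, ← ha, ← Functor.map_comp, hz, Functor.map_zero,
        zero_comp]
    obtain ⟨k, hk⟩ := Triangle.coyoneda_exact₂ _ (inv_rot_of_distTriang _ hT) _ h
    have : (((singleFunctor C 0).obj X)⟦(-1 : ℤ)⟧).IsGE 1 :=
      TStructure.t.isGE_shift _ 0 (-1) 1
    have hk₀ : k = 0 := TStructure.t.zero_of_isLE_of_isGE k 0 1 (by lia) inferInstance this
    rw [Functor.map_zero]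
    rw [hk, hk₀]
    exact zero_comp
  · have h : η ≫ f⟦(1 : ℤ)⟧' = 0 := comp_distTriang_mor_zero₃₁ _ hT
    rw [ha, Functor.map_comp, ← Category.assoc, h, zero_comp]

end DerivedCategory

lemma CategoryTheory.Abelian.Ext.exists_mono_comp_mk₀_eq_zero {C : Type u} [Category.{v} C]
    [Abelian C] [HasExt.{w} C] {X Y : C} (η : Ext X Y 1) :
    ∃ (E : C) (a : Y ⟶ E), Mono a ∧ η.comp (Ext.mk₀ a) (add_zero 1) = 0 := by
  let := HasDerivedCategory.standard C
  obtain ⟨E, a, ha, h⟩ :=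
    DerivedCategory.exists_mono_comp_singleFunctor_map_shift_eq_zero η.hom
  refine ⟨E, a, ha, ?_⟩
  ext
  rw [← Ext.hom_comp_singleFunctor_map_shift, Ext.zero_hom]
  exact h

namespace CategoryTheory.Limits.Sigma

variable {A : Type u} [Category.{v} A] {I : Type w} {X Y Z : I → A}
  [HasCoproduct X] [HasCoproduct Y] [HasCoproduct Z] (f : ∀ i, X i ⟶ Y i) (g : ∀ i, Y i ⟶ Z i)

lemma epi_map (hg : ∀ i, Epi (g i)) : Epi (Limits.Sigma.map g) where
  left_cancellation m m' h := by
    refine Limits.Sigma.hom_ext _ _ fun i => ?_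
    rw [← cancel_epi (g i), ← Limits.Sigma.ι_map_assoc, ← Limits.Sigma.ι_map_assoc, h]

variable [Abelian A]

/-- Coproducts are right exact. -/
lemma exact_map (w : ∀ i, f i ≫ g i = 0)
    (hS : ∀ i, (ShortComplex.mk (f i) (g i) (w i)).Exact) (hg : ∀ i, Epi (g i))
    (w' : Limits.Sigma.map f ≫ Limits.Sigma.map g = 0) :
    (ShortComplex.mk (Limits.Sigma.map f) (Limits.Sigma.map g) w').Exact := by
  have := epi_map g hg
  have hfac {T : A} (k : ∐ Y ⟶ T) (hk : Limits.Sigma.map f ≫ k = 0) :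
      ∃ l : ∐ Z ⟶ T, Limits.Sigma.map g ≫ l = k := by
    have hk' (i : I) : f i ≫ Sigma.ι Y i ≫ k = 0 := by
      rw [← Limits.Sigma.ι_map_assoc, hk, comp_zero]
    refine ⟨Sigma.desc fun i => (hS i).desc _ (hk' i), Limits.Sigma.hom_ext _ _ fun i => ?_⟩
    rw [Limits.Sigma.ι_map_assoc, Limits.Sigma.ι_desc]
    exact (hS i).g_desc _ _
  choose l hl using @hfac
  exact ShortComplex.exact_of_g_is_cokernel _ (CokernelCofork.IsColimit.ofπ _ _ l hl
    fun k hk m hm => by rw [← cancel_epi (Limits.Sigma.map g)]; exact hm.trans (hl k hk).symm)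

end CategoryTheory.Limits.Sigma

lemma sigmaShortComplex_shortExact_of_mono {A : Type u} [Category.{v} A] [Abelian A]
    {I : Type w} (S : I → ShortComplex A)
    [HasCoproduct (fun i => (S i).X₁)] [HasCoproduct (fun i => (S i).X₂)]
    [HasCoproduct (fun i => (S i).X₃)] (hS : ∀ i, (S i).ShortExact)
    (hf : Mono (Limits.Sigma.map fun i => (S i).f)) : (sigmaShortComplex S).ShortExact where
  exact := Limits.Sigma.exact_map _ _ (fun i => (S i).zero) (fun i => (hS i).exact)
    (fun i => (hS i).epi_g) _
  mono_f := hf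
  epi_g := Limits.Sigma.epi_map _ fun i => (hS i).epi_g

/-- A coproduct of short exact sequences remains exact on the left as soon as the pushouts of
their extension classes to the coproduct come from a single extension. -/
lemma mono_sigma_map_f {A : Type u} [Category.{v} A] [Abelian A] [HasCoproducts.{v} A]
    [CategoryTheory.HasExt.{w} A] {I : Type v} (S : I → ShortComplex A)
    (hS : ∀ i, (S i).ShortExact)
    (η : Ext (∐ fun i => (S i).X₃) (∐ fun i => (S i).X₁) 1)
    (hη : ∀ i, (Ext.mk₀ (Sigma.ι (fun i => (S i).X₃) i)).comp η (zero_add 1) =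
      (hS i).extClass.comp (Ext.mk₀ (Sigma.ι (fun i => (S i).X₁) i)) (add_zero 1)) :
    Mono (Limits.Sigma.map fun i => (S i).f) := by
  obtain ⟨E, a, ha, h⟩ := η.exists_mono_comp_mk₀_eq_zero
  have key (i : I) : ∃ φ : (S i).X₂ ⟶ E, (S i).f ≫ φ = Sigma.ι (fun i => (S i).X₁) i ≫ a := by
    obtain ⟨x, hx⟩ := Ext.contravariant_sequence_exact₁ (hS i) E
      (Ext.mk₀ (Sigma.ι (fun i => (S i).X₁) i ≫ a)) (add_zero 1) (by
        rw [← Ext.mk₀_comp_mk₀, ← Ext.comp_assoc_of_third_deg_zero, ← hη,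
          Ext.comp_assoc_of_third_deg_zero, h, Ext.comp_zero])
    obtain ⟨φ, rfl⟩ := (Ext.mk₀_bijective _ _).surjective x
    rw [Ext.mk₀_comp_mk₀] at hx
    exact ⟨φ, (Ext.mk₀_bijective _ _).injective hx⟩
  choose φ hφ using key
  have fac : Limits.Sigma.map (fun i => (S i).f) ≫ Sigma.desc φ = a := by
    refine Limits.Sigma.hom_ext _ _ fun i => ?_
    rw [Limits.Sigma.ι_map_assoc, Limits.Sigma.ι_desc, hφ]
  exact mono_of_mono_fac fac

/-- if `A` is an AB3 abelian category in which, for every nonempty set `I`,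
family `{A_i}` and object `B`, the canonical map `Ext¹(⨁ A_i, B) → ∏ Ext¹(A_i, B)` is an
isomorphism, then `A` is AB4: the coproduct of any family of short exact sequences is
short exact. -/
theorem stmt10 {A : Type u} [Category.{v} A] [Abelian A] [HasCoproducts.{v} A]
    [CategoryTheory.HasExt.{w} A]
    (hτ : ∀ (I : Type v), Nonempty I → ∀ (f : I → A) (B : A),
      Function.Bijective (fun (η : Ext (∐ f) B 1) (i : I) =>
        (Ext.mk₀ (Sigma.ι f i)).comp η (zero_add 1))) :
    ∀ (I : Type v) (S : I → ShortComplex A), (∀ i, (S i).ShortExact) →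
      (sigmaShortComplex S).ShortExact := by
  intro I S hS
  refine sigmaShortComplex_shortExact_of_mono S hS ?_
  rcases isEmpty_or_nonempty I with _ | hI
  · exact ⟨fun _ _ _ => ((IsZero.iff_id_eq_zero _).2
      (Limits.Sigma.hom_ext _ _ fun i => isEmptyElim i)).eq_of_tgt _ _⟩
  · obtain ⟨η, hη⟩ := (hτ I hI (fun i => (S i).X₃) (∐ fun i => (S i).X₁)).surjective fun i =>
      (hS i).extClass.comp (Ext.mk₀ (Sigma.ι (fun i => (S i).X₁) i)) (add_zero 1)
    exact mono_sigma_map_f S hS η (congrFun hη)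
end

section
/- Let A be an abelian category with enough projectives such that Ext^i_A(−,−) = 0 for all i > n (global dimension ≤ n), with A AB3. In the derived category D(A), the standard t-structure (D^{≤0}, D^{≥0}) is n-smashing: any small coproduct of objects of D^{≥0} lies in Σ^n D^{≥0}, i.e. has cohomology concentrated in degrees ≥ −n. -/
open CategoryTheory CategoryTheory.Limits

universe w v u

/-- A morphism of complexes that is a monomorphism in degree `j` and an epimorphism in the
previous degree induces a monomorphism on homology in degree `j`. -/
lemma HomologicalComplex.mono_homologyMap_of_mono_of_epi {C ι : Type*} [Category* C] [Abelian C]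
    {c : ComplexShape ι} {K L : HomologicalComplex C c} (φ : K ⟶ L) (i j : ι)
    (hi : c.prev j = i) [Mono (φ.f j)] [Epi (φ.f i)] :
    Mono (homologyMap φ j) := by
  rw [mono_homologyMap_iff_up_to_refinements φ i j _ hi rfl]
  intro T x₂ _ y₁ hy
  obtain ⟨T', π, hπ, x₁, hx₁⟩ := surjective_up_to_refinements_of_epi (φ.f i) y₁
  refine ⟨T', π, hπ, x₁, ?_⟩
  rw [← cancel_mono (φ.f j), Category.assoc, hy, ← Category.assoc, hx₁, Category.assoc, Category.assoc,
    φ.comm]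

/-- Every cochain complex maps to a complex in degrees `≤ m` (its stupid truncation) by a morphism
which is a monomorphism on homology in degrees `≤ m`. -/
lemma CochainComplex.exists_hom_isStrictlyLE_mono_homologyMap {C : Type*} [Category* C]
    [Abelian C] (K : CochainComplex C ℤ) (m : ℤ) :
    ∃ (L : CochainComplex C ℤ) (_ : L.IsStrictlyLE m) (φ : K ⟶ L),
      ∀ k ≤ m, Mono (HomologicalComplex.homologyMap φ k) := by
  let e := ComplexShape.embeddingUpIntLE m
  have he : e.HasLift (𝟙 (K.restriction e)) := fun j hj _ _ ↦
    (hj.2 (j + 1) (e.rel (by simp))).elim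
  refine ⟨(K.restriction e).extend e, inferInstance, e.liftExtend _ he, fun k hk ↦ ?_⟩
  have hf (l : ℤ) (hl : l ≤ m) : IsIso ((e.liftExtend _ he).f l) := by
    have hl' : e.f (m - l).toNat = l := by simp only [e, ComplexShape.embeddingUpIntLE_f]; lia
    rw [e.isIso_liftExtend_f_iff _ he hl']
    exact inferInstanceAs (IsIso (𝟙 _))
  have := hf k hk
  have := hf (k - 1) (by lia)
  exact HomologicalComplex.mono_homologyMap_of_mono_of_epi _ (k - 1) k (by simp)

/-- Every object of the derived category maps to an object with cohomology in degrees `≤ m`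
by a morphism which is a monomorphism on cohomology in degrees `≤ m`. -/
lemma DerivedCategory.exists_hom_mono_homologyFunctor_map {C : Type u} [Category.{v} C]
    [Abelian C] [HasDerivedCategory.{w} C] (X : DerivedCategory C) (m : ℤ) :
    ∃ (Y : DerivedCategory C) (_ : Y.IsLE m) (φ : X ⟶ Y),
      ∀ k ≤ m, Mono ((homologyFunctor C k).map φ) := by
  obtain ⟨L, _, φ, hφ⟩ := (Q.objPreimage X).exists_hom_isStrictlyLE_mono_homologyMap m
  refine ⟨Q.obj L, inferInstance, (Q.objObjPreimageIso X).inv ≫ Q.map φ, fun k hk ↦ ?_⟩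
  have : Mono ((homologyFunctor C k).map (Q.map φ)) :=
    ((MorphismProperty.monomorphisms C).arrow_mk_iso_iff
      (((Functor.mapArrowFunctor _ _).mapIso (homologyFunctorFactors C k)).app
        (Arrow.mk φ))).2 (hφ k hk)
  rw [Functor.map_comp]
  infer_instance

/-- let `A` be an AB3 abelian category with enough projectives whose
standard t-structure on `D(A)` has global dimension `≤ n`
(i.e. `Hom_{D(A)}(D^{≥0}, Σ^{n+1} D^{≤0}) = 0`, where membership in `D^{≥0}` resp.
`Σ^{n+1} D^{≤0}` is expressed by vanishing of cohomology in degrees `< 0` resp.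
`> -(n+1)`). Then the standard t-structure is `n`-smashing: any small coproduct of
objects of `D^{≥0}` has cohomology concentrated in degrees `≥ -n`, i.e. lies
in `Σ^n D^{≥0}`. -/
theorem stmt17 {A : Type u} [Category.{v} A] [Abelian A] [HasCoproducts.{v} A]
    [EnoughProjectives A] [HasDerivedCategory.{w} A]
    [HasCoproducts.{v} (DerivedCategory A)] (n : ℕ)
    (hdim : ∀ X Y : DerivedCategory A,
      (∀ k : ℤ, k < 0 → IsZero ((DerivedCategory.homologyFunctor A k).obj X)) →
      (∀ k : ℤ, -(n + 1 : ℤ) < k → IsZero ((DerivedCategory.homologyFunctor A k).obj Y)) →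
      ∀ f : X ⟶ Y, f = 0) :
    ∀ (I : Type v) (X : I → DerivedCategory A),
      (∀ (i : I) (k : ℤ), k < 0 →
        IsZero ((DerivedCategory.homologyFunctor A k).obj (X i))) →
      ∀ k : ℤ, k < -(n : ℤ) →
        IsZero ((DerivedCategory.homologyFunctor A k).obj (∐ X)) := by
  intro I X hX k hk
  obtain ⟨Y, hY, φ, hφ⟩ :=
    DerivedCategory.exists_hom_mono_homologyFunctor_map (∐ X) (-(n + 1 : ℤ))
  have hφ₀ : φ = 0 := Sigma.hom_ext _ _ fun i ↦ by
    rw [hdim (X i) Y (hX i) ((DerivedCategory.isLE_iff _ _).1 hY) (Sigma.ι X i ≫ φ), comp_zero]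
  have := hφ k (by lia)
  rw [IsZero.iff_id_eq_zero, ← cancel_mono ((DerivedCategory.homologyFunctor A k).map φ),
    hφ₀, Functor.map_zero, comp_zero, comp_zero]
end
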